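/- Let ν be an ℓ-core with ν_i - ν_{i+1} = ℓ-1 for i = 1, ..., r and ν_{r+1} - ν_{r+2} ≠ ℓ-1. Then the number of ℓ-partitions of weight w with ℓ-core ν equals the number of partitions of w into at most r+1 parts. -/

import Mathlib

/-- The hook length of the box `(a, b)` (0-indexed row `a`, column `b`)
of the Young diagram `μ`: the number of boxes to the right in its row,
plus the number of boxes below in its column, plus one. -/
def hookLen (μ : YoungDiagram) (a b : ℕ) : ℕ :=
  μ.rowLen a + μ.colLen b - a - b - 1

/-- A partition (Young diagram) is an `ℓ`-core when no box has hook length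
divisible by `ℓ`. -/
def IsCore (ℓ : ℕ) (μ : YoungDiagram) : Prop :=
  ∀ a b : ℕ, (a, b) ∈ μ → ¬ ℓ ∣ hookLen μ a b

/-- Two cells are adjacent if they share an edge. -/
def AdjCell (p q : ℕ × ℕ) : Prop :=
  (p.1 = q.1 ∧ (p.2 = q.2 + 1 ∨ q.2 = p.2 + 1)) ∨
  (p.2 = q.2 ∧ (p.1 = q.1 + 1 ∨ q.1 = p.1 + 1))

/-- A finite set of cells is connected if any two of its cells are joined by a
path of edge-adjacent cells inside the set. -/
def ConnectedCells (s : Finset (ℕ × ℕ)) : Prop :=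
  ∀ p ∈ s, ∀ q ∈ s,
    Relation.ReflTransGen (fun x y => x ∈ s ∧ y ∈ s ∧ AdjCell x y) p q

/-- A set of cells contains no 2×2 square. -/
def No2x2 (s : Finset (ℕ × ℕ)) : Prop :=
  ¬ ∃ a b : ℕ, (a, b) ∈ s ∧ (a + 1, b) ∈ s ∧ (a, b + 1) ∈ s ∧ (a + 1, b + 1) ∈ s

/-- `s` is a removable `ℓ`-rim hook of the Young diagram `lam`: a connected set of
`ℓ` cells of `lam`, containing no 2×2 square, whose removal from `lam` leaves the
Young diagram of a partition. -/
def IsRemovableRimHook (ℓ : ℕ) (lam : YoungDiagram) (s : Finset (ℕ × ℕ)) : Prop :=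
  ∃ μ : YoungDiagram, μ.cells ⊆ lam.cells ∧ s = lam.cells \ μ.cells ∧
    s.card = ℓ ∧ ConnectedCells s ∧ No2x2 s

/-- A set of cells all lying in a single row. -/
def HorizontalCells (s : Finset (ℕ × ℕ)) : Prop := ∀ p ∈ s, ∀ q ∈ s, p.1 = q.1

/-- A set of cells all lying in a single column. -/
def VerticalCells (s : Finset (ℕ × ℕ)) : Prop := ∀ p ∈ s, ∀ q ∈ s, p.2 = q.2

/-- Carter's condition (⋆): for all pairs of boxes in the same column of `lam`,
`ℓ` divides one hook length iff it divides the other. -/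
def StarCond (ℓ : ℕ) (lam : YoungDiagram) : Prop :=
  ∀ a b c : ℕ, (a, c) ∈ lam → (b, c) ∈ lam →
    (ℓ ∣ hookLen lam a c ↔ ℓ ∣ hookLen lam b c)

/-- `b` is obtained from `a` by removing a horizontal `ℓ`-rim hook;
equivalently `a` is obtained from `b` by adding a horizontal `ℓ`-rim hook. -/
def RemoveHorizHook (ℓ : ℕ) (a b : YoungDiagram) : Prop :=
  ∃ s, IsRemovableRimHook ℓ a s ∧ HorizontalCells s ∧ b.cells = a.cells \ s

/-- A partition is `ℓ`-regular if it has no `ℓ` equal nonzero parts. -/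
def Regular (ℓ : ℕ) (lam : YoungDiagram) : Prop :=
  ∀ i : ℕ, lam.rowLen i = lam.rowLen (i + ℓ - 1) → lam.rowLen i = 0

/-- An `ℓ`-partition: an `ℓ`-regular partition each of whose removable `ℓ`-rim hooks
is horizontal, and such that this remains true after removing any sequence of
horizontal `ℓ`-rim hooks. -/
def IsEllPartition (ℓ : ℕ) (lam : YoungDiagram) : Prop :=
  Regular ℓ lam ∧
  ∀ μ : YoungDiagram, Relation.ReflTransGen (RemoveHorizHook ℓ) lam μ →
    ∀ s, IsRemovableRimHook ℓ μ s → HorizontalCells s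

/-- `b` is obtained from `a` by removing one removable `ℓ`-rim hook. -/
def RemoveHook (ℓ : ℕ) (a b : YoungDiagram) : Prop :=
  ∃ s, IsRemovableRimHook ℓ a s ∧ b.cells = a.cells \ s

namespace YoungDiagram

theorem ext_rowLen {μ lam : YoungDiagram} (h : ∀ i, μ.rowLen i = lam.rowLen i) : μ = lam := by
  ext ⟨i, j⟩
  simp [mem_iff_lt_rowLen, h]

theorem exists_rowLen_eq (f : ℕ → ℕ) (hf : ∀ i, f (i + 1) ≤ f i) (N : ℕ) (hN : f N = 0) :
    ∃ μ : YoungDiagram, ∀ i, μ.rowLen i = f i := by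
  have hanti : Antitone f := antitone_nat_of_succ_le hf
  have hlow : IsLowerSet
      (((Finset.range N ×ˢ Finset.range (f 0)).filter fun p => p.2 < f p.1 : Finset (ℕ × ℕ)) :
        Set (ℕ × ℕ)) := by
    rintro ⟨i, j⟩ ⟨i', j'⟩ h hm
    obtain ⟨h1, h2⟩ := Prod.mk_le_mk.mp h
    simp only [Finset.mem_coe, Finset.mem_filter, Finset.mem_product, Finset.mem_range] at hm ⊢
    have := hanti h1
    have := hanti (Nat.zero_le i')
    omega
  refine ⟨⟨_, hlow⟩, fun i => eq_of_forall_lt_iff fun j => ?_⟩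
  rw [← mem_iff_lt_rowLen, mem_mk]
  simp only [Finset.mem_filter, Finset.mem_product, Finset.mem_range]
  refine ⟨fun h => h.2, fun h => ⟨⟨?_, h.trans_le (hanti (Nat.zero_le i))⟩, h⟩⟩
  by_contra! hi
  have := hanti hi
  omega

theorem rowLen_succ_le (μ : YoungDiagram) (i : ℕ) : μ.rowLen (i + 1) ≤ μ.rowLen i :=
  μ.rowLen_anti _ _ (Nat.le_succ i)

theorem rowLen_eq_zero_iff {μ : YoungDiagram} {i : ℕ} : μ.rowLen i = 0 ↔ μ.colLen 0 ≤ i := by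
  rw [← not_lt, ← mem_iff_lt_colLen, mem_iff_lt_rowLen]
  omega

theorem card_cells_eq_sum (μ : YoungDiagram) (N : ℕ) (hN : μ.rowLen N = 0) :
    μ.cells.card = ∑ i ∈ Finset.range N, μ.rowLen i := by
  rw [Finset.card_eq_sum_card_fiberwise (f := Prod.fst) (t := Finset.range N)]
  · exact Finset.sum_congr rfl fun i _ => μ.rowLen_eq_card.symm
  · rintro ⟨i, j⟩ h
    have h' : j < μ.rowLen i := mem_iff_lt_rowLen.mp h
    simp only [Finset.coe_range, Set.mem_Iio]
    by_contra! hi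
    have := μ.rowLen_anti _ _ hi
    omega

theorem mem_cells_sdiff {μ lam : YoungDiagram} {i j : ℕ} :
    (i, j) ∈ lam.cells \ μ.cells ↔ μ.rowLen i ≤ j ∧ j < lam.rowLen i := by
  rw [Finset.mem_sdiff, mem_cells, mem_cells, mem_iff_lt_rowLen, mem_iff_lt_rowLen]
  omega

theorem rowLen_le_of_cells_subset {μ lam : YoungDiagram} (h : μ.cells ⊆ lam.cells) (i : ℕ) :
    μ.rowLen i ≤ lam.rowLen i := by
  by_contra! hlt
  exact lt_irrefl _ (mem_iff_lt_rowLen.mp (h (mem_iff_lt_rowLen.mpr hlt : (i, _) ∈ μ)))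

theorem cells_subset_of_rowLen_le {μ lam : YoungDiagram} (h : ∀ i, μ.rowLen i ≤ lam.rowLen i) :
    μ.cells ⊆ lam.cells := by
  rintro ⟨i, j⟩ hij
  exact mem_iff_lt_rowLen.mpr ((mem_iff_lt_rowLen.mp hij).trans_le (h i))

theorem card_row_cells_sdiff (μ lam : YoungDiagram) (i : ℕ) :
    ((lam.cells \ μ.cells).filter fun p => p.1 = i).card = lam.rowLen i - μ.rowLen i := by
  have : ((lam.cells \ μ.cells).filter fun p => p.1 = i) =
      {i} ×ˢ Finset.Ico (μ.rowLen i) (lam.rowLen i) := by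
    ext ⟨a, j⟩
    rw [Finset.mem_filter, mem_cells_sdiff, Finset.mem_product, Finset.mem_singleton,
      Finset.mem_Ico]
    constructor
    · rintro ⟨h, rfl⟩
      exact ⟨rfl, h⟩
    · rintro ⟨rfl, h⟩
      exact ⟨h, rfl⟩
  rw [this]
  simp

end YoungDiagram

open YoungDiagram

/-- One step between adjacent cells of `s`. -/
def CellStep (s : Finset (ℕ × ℕ)) (x y : ℕ × ℕ) : Prop := x ∈ s ∧ y ∈ s ∧ AdjCell x y

theorem CellStep.symm {s : Finset (ℕ × ℕ)} {x y : ℕ × ℕ} (h : CellStep s x y) :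
    CellStep s y x := by
  obtain ⟨hx, hy, h⟩ := h
  refine ⟨hy, hx, ?_⟩
  unfold AdjCell at *
  omega

theorem cellPath_symm {s : Finset (ℕ × ℕ)} {x y : ℕ × ℕ}
    (h : Relation.ReflTransGen (CellStep s) x y) : Relation.ReflTransGen (CellStep s) y x :=
  haveI : Std.Symm (CellStep s) := ⟨fun _ _ => CellStep.symm⟩
  Std.Symm.symm _ _ h

theorem connectedCells_of_base {s : Finset (ℕ × ℕ)} (x : ℕ × ℕ)
    (h : ∀ p ∈ s, Relation.ReflTransGen (CellStep s) p x) : ConnectedCells s :=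
  fun p hp q hq => (h p hp).trans (cellPath_symm (h q hq))

theorem cellPath_row {s : Finset (ℕ × ℕ)} {a c d : ℕ} (hcd : c ≤ d)
    (h : ∀ j, c ≤ j → j ≤ d → (a, j) ∈ s) :
    Relation.ReflTransGen (CellStep s) (a, d) (a, c) := by
  induction d, hcd using Nat.le_induction with
  | base => exact .refl
  | succ d hcd ih =>
    refine .head ⟨h _ (by omega) le_rfl, h d hcd (by omega), ?_⟩
      (ih fun j h1 h2 => h j h1 (by omega))
    simp [AdjCell]

theorem exists_column_of_cellPath {s : Finset (ℕ × ℕ)} {i : ℕ} {p q : ℕ × ℕ}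
    (h : Relation.ReflTransGen (CellStep s) p q) (hp : p.1 ≤ i) (hq : i < q.1) :
    ∃ c, (i, c) ∈ s ∧ (i + 1, c) ∈ s := by
  induction h using Relation.ReflTransGen.head_induction_on with
  | refl => omega
  | @head x y hxy _ ih =>
    rcases le_or_gt y.1 i with hy | hy
    · exact ih hy
    · obtain ⟨hx, hys, hadj⟩ := hxy
      obtain ⟨x1, x2⟩ := x
      obtain ⟨y1, y2⟩ := y
      simp only [AdjCell] at *
      obtain rfl : x1 = i := by omega
      obtain rfl : y1 = x1 + 1 := by omega
      obtain rfl : x2 = y2 := by omega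
      exact ⟨_, hx, hys⟩

theorem RemoveHorizHook.removeHook {ℓ : ℕ} {lam μ : YoungDiagram} (h : RemoveHorizHook ℓ lam μ) :
    RemoveHook ℓ lam μ :=
  h.imp fun _ hs => ⟨hs.1, hs.2.2⟩

theorem RemoveHorizHook.exists_row {ℓ : ℕ} (hℓ : 1 ≤ ℓ) {lam μ : YoungDiagram}
    (h : RemoveHorizHook ℓ lam μ) :
    ∃ a, lam.rowLen a = μ.rowLen a + ℓ ∧ ∀ i, i ≠ a → lam.rowLen i = μ.rowLen i := by
  obtain ⟨s, ⟨μ', hsub, rfl, hcard, -, -⟩, hhor, hμ⟩ := h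
  obtain rfl : μ = μ' := YoungDiagram.ext (by rw [hμ, Finset.sdiff_sdiff_eq_self hsub])
  obtain ⟨⟨a, c⟩, hac⟩ := Finset.card_pos.mp (hcard ▸ hℓ)
  refine ⟨a, ?_, fun i hi => ?_⟩
  · have := card_row_cells_sdiff μ lam a
    rw [Finset.filter_true_of_mem fun p hp => hhor p hp _ hac, hcard] at this
    omega
  · have h1 := rowLen_le_of_cells_subset hsub i
    by_contra hne
    have : (i, μ.rowLen i) ∈ lam.cells \ μ.cells := mem_cells_sdiff.mpr (by omega)
    exact hi (hhor _ this _ hac)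

theorem removeHorizHook_of_rowLen {ℓ : ℕ} {lam μ : YoungDiagram} (a : ℕ)
    (ha : lam.rowLen a = μ.rowLen a + ℓ) (h : ∀ i, i ≠ a → lam.rowLen i = μ.rowLen i) :
    RemoveHorizHook ℓ lam μ := by
  have hsub : μ.cells ⊆ lam.cells := cells_subset_of_rowLen_le fun i => by
    rcases eq_or_ne i a with rfl | hi
    · omega
    · exact (h i hi).ge
  have hrow : ∀ p ∈ lam.cells \ μ.cells, p.1 = a := by
    rintro ⟨i, j⟩ hp
    by_contra hi
    have := mem_cells_sdiff.mp hp
    have := h i hi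
    omega
  have hhor : HorizontalCells (lam.cells \ μ.cells) := fun p hp q hq =>
    (hrow p hp).trans (hrow q hq).symm
  refine ⟨_, ⟨μ, hsub, rfl, ?_, ?_, ?_⟩, hhor, (Finset.sdiff_sdiff_eq_self hsub).symm⟩
  · have := card_row_cells_sdiff μ lam a
    rw [Finset.filter_true_of_mem hrow] at this
    omega
  · refine connectedCells_of_base (a, μ.rowLen a) ?_
    rintro ⟨i, j⟩ hp
    obtain rfl : i = a := hrow _ hp
    have := mem_cells_sdiff.mp hp
    exact cellPath_row this.1 fun k h1 h2 => mem_cells_sdiff.mpr (by omega)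
  · rintro ⟨i, j, h1, h2, -⟩
    have := hhor _ h1 _ h2
    simp at this

/-- A removable rim hook meeting rows `a` to `b` with `a < b` moves the beta number of row `a`
strictly between those of rows `b` and `b + 1`. -/
theorem IsRemovableRimHook.exists_rows {ℓ : ℕ} {lam : YoungDiagram} {s : Finset (ℕ × ℕ)}
    (h : IsRemovableRimHook ℓ lam s) (hs : ¬ HorizontalCells s) :
    ∃ a b, a < b ∧ lam.rowLen a + b < lam.rowLen b + a + ℓ ∧
      lam.rowLen (b + 1) + a + ℓ ≤ lam.rowLen a + b := by
  obtain ⟨μ, hsub, rfl, hcard, hconn, hsq⟩ := h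
  simp only [HorizontalCells, not_forall] at hs
  obtain ⟨p, hp, q, hq, hpq⟩ := hs
  obtain ⟨⟨a, ca⟩, hmem_a, hmin⟩ := Finset.exists_min_image _ Prod.fst ⟨p, hp⟩
  obtain ⟨⟨b, cb⟩, hmem_b, hmax⟩ := Finset.exists_max_image _ Prod.fst ⟨p, hp⟩
  simp only at hmin hmax
  have hab : a < b := by
    have := hmin p hp; have := hmin q hq; have := hmax p hp; have := hmax q hq
    omega
  have hstep : ∀ i, a ≤ i → i < b → lam.rowLen (i + 1) = μ.rowLen i + 1 := by
    intro i hai hib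
    obtain ⟨c, h1, h2⟩ := exists_column_of_cellPath (hconn _ hmem_a _ hmem_b) hai hib
    rw [mem_cells_sdiff] at h1 h2
    by_contra hne
    have := lam.rowLen_succ_le i
    have := μ.rowLen_succ_le i
    exact hsq ⟨i, μ.rowLen i, mem_cells_sdiff.mpr (by omega), mem_cells_sdiff.mpr (by omega),
      mem_cells_sdiff.mpr (by omega), mem_cells_sdiff.mpr (by omega)⟩
  have hsum : ∀ k, a + k ≤ b → ∑ i ∈ Finset.Ico a (a + k), (lam.rowLen i - μ.rowLen i) +
      lam.rowLen (a + k) = lam.rowLen a + k := by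
    intro k
    induction k with
    | zero => simp
    | succ k ih =>
      intro hk
      have h1 := ih (by omega)
      have h2 := hstep (a + k) (by omega) (by omega)
      have h3 := lam.rowLen_succ_le (a + k)
      rw [← add_assoc, Finset.sum_Ico_succ_top (by omega)]
      omega
  have hcard' : ∑ i ∈ Finset.Ico a (b + 1), (lam.rowLen i - μ.rowLen i) = ℓ := by
    rw [← hcard, Finset.card_eq_sum_card_fiberwise (f := Prod.fst) (t := Finset.Ico a (b + 1))]
    · exact Finset.sum_congr rfl fun i _ => (card_row_cells_sdiff μ lam i).symm
    · intro x hx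
      have h1 := hmin x hx
      have h2 := hmax x hx
      simp only [Finset.coe_Ico, Set.mem_Ico]
      omega
  have h1 := hsum (b - a) (by omega)
  rw [show a + (b - a) = b by omega] at h1
  rw [Finset.sum_Ico_succ_top (by omega)] at hcard'
  have h2 := mem_cells_sdiff.mp hmem_b
  have h3 : lam.rowLen (b + 1) ≤ μ.rowLen b := by
    by_contra! hlt
    have h4 := μ.rowLen_succ_le b
    have := hmax (b + 1, μ.rowLen b) (mem_cells_sdiff.mpr (by omega))
    simp at this
  exact ⟨a, b, hab, by omega, by omega⟩

/-- Removing from rows `a` and `a + 1` the rim hook of length `ℓ` starting in row `a`. -/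
theorem exists_not_horizontal_rimHook {ℓ : ℕ} {lam : YoungDiagram} {a : ℕ}
    (h1 : lam.rowLen a + 1 < lam.rowLen (a + 1) + ℓ)
    (h2 : lam.rowLen (a + 2) + ℓ ≤ lam.rowLen a + 1) :
    ∃ s, IsRemovableRimHook ℓ lam s ∧ ¬ HorizontalCells s := by
  have hanti := lam.rowLen_succ_le
  have hpos : 1 ≤ lam.rowLen (a + 1) := by
    have := hanti (a + 1)
    omega
  obtain ⟨μ, hμ⟩ := exists_rowLen_eq
    (fun i => if i = a then lam.rowLen (a + 1) - 1 else
      if i = a + 1 then lam.rowLen a + 1 - ℓ else lam.rowLen i)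
    (fun i => by
      rcases eq_or_ne i a with rfl | hia
      · simp only [Nat.succ_ne_self, if_true, if_false]
        omega
      rcases eq_or_ne i (a + 1) with rfl | hia1
      · simp only [Nat.succ_ne_self, if_true, if_false, show a + 1 + 1 ≠ a by omega]
        change lam.rowLen (a + 2) ≤ lam.rowLen a + 1 - ℓ
        omega
      · have h3 := hanti i
        rw [if_neg hia, if_neg hia1, if_neg (by omega : i + 1 ≠ a + 1)]
        split_ifs with h4
        · subst h4
          have := hanti (i + 1)
          omega
        · exact h3)
    (lam.colLen 0 + a + 2)
    (by simp [rowLen_eq_zero_iff, add_assoc, show lam.colLen 0 + (a + 2) ≠ a by omega,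
          show lam.colLen 0 + (a + 2) ≠ a + 1 by omega])
  have ha : μ.rowLen a + 1 = lam.rowLen (a + 1) := by
    rw [hμ a, if_pos rfl]
    omega
  have ha1 : μ.rowLen (a + 1) + ℓ = lam.rowLen a + 1 := by
    rw [hμ, if_neg (by omega), if_pos rfl]
    omega
  have hother : ∀ i, i ≠ a → i ≠ a + 1 → μ.rowLen i = lam.rowLen i := fun i h3 h4 => by
    rw [hμ, if_neg h3, if_neg h4]
  have haa := hanti a
  have hrows : ∀ p ∈ lam.cells \ μ.cells, p.1 = a ∨ p.1 = a + 1 := by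
    rintro ⟨i, j⟩ hp
    by_contra! hi
    have := mem_cells_sdiff.mp hp
    have := hother i hi.1 hi.2
    omega
  refine ⟨_, ⟨μ, cells_subset_of_rowLen_le fun i => ?_, rfl, ?_, ?_, ?_⟩, fun hhor => ?_⟩
  · rcases eq_or_ne i a with rfl | h3
    · omega
    rcases eq_or_ne i (a + 1) with rfl | h4
    · omega
    exact (hother i h3 h4).le
  · rw [Finset.card_eq_sum_card_fiberwise (f := Prod.fst) (t := {a, a + 1}),
      Finset.sum_pair (by omega), card_row_cells_sdiff, card_row_cells_sdiff]
    · omega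
    · intro p hp
      simpa using hrows p hp
  · refine connectedCells_of_base (a, μ.rowLen a) ?_
    rintro ⟨i, j⟩ hp
    have hj := mem_cells_sdiff.mp hp
    rcases hrows _ hp with hi | hi <;> obtain rfl : i = _ := hi
    · exact cellPath_row hj.1 fun k _ _ => mem_cells_sdiff.mpr (by omega)
    · refine (cellPath_symm (cellPath_row (d := μ.rowLen a) (by omega)
        fun k _ _ => mem_cells_sdiff.mpr (by omega))).trans (.single ⟨?_, ?_, ?_⟩)
      · exact mem_cells_sdiff.mpr (by omega)
      · exact mem_cells_sdiff.mpr (by omega)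
      · simp [AdjCell]
  · rintro ⟨i, j, h3, h4, h5, h6⟩
    have := hrows _ h3
    have := hrows _ h4
    obtain rfl : i = a := by simp only at *; omega
    rw [mem_cells_sdiff] at h3 h6
    omega
  · have := hhor (a, μ.rowLen a) (mem_cells_sdiff.mpr (by omega))
      (a + 1, μ.rowLen a) (mem_cells_sdiff.mpr (by omega))
    simp at this

/-- The beta numbers of an `ℓ`-core are closed under subtracting `ℓ`. -/
theorem IsCore.exists_row {ℓ : ℕ} {ν : YoungDiagram} (h : IsCore ℓ ν) (a : ℕ) :
    ∃ c, ν.rowLen a + c = ν.rowLen c + a + ℓ := by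
  by_contra! hne
  have hex : ∃ d, ν.rowLen d + a + ℓ < ν.rowLen a + d := by
    refine ⟨ν.rowLen 0 + a + ℓ + 1, ?_⟩
    have := ν.rowLen_anti 0 (ν.rowLen 0 + a + ℓ + 1) (Nat.zero_le _)
    omega
  classical
  have hd := Nat.find_spec hex
  have had : a < Nat.find hex := by
    by_contra! hle
    have := ν.rowLen_anti _ _ hle
    omega
  obtain ⟨c, hc⟩ : ∃ c, Nat.find hex = c + 1 := ⟨Nat.find hex - 1, by omega⟩
  have hmin := Nat.find_min hex (m := c) (by omega)
  rw [hc] at hd had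
  have hc' := hne c
  have hca := ν.rowLen_anti a c (by omega)
  obtain ⟨b, hb⟩ : ∃ b, b + a + ℓ = ν.rowLen a + c := ⟨ν.rowLen a + c - a - ℓ, by omega⟩
  have h1 : c < ν.colLen b := by
    rw [← mem_iff_lt_colLen, mem_iff_lt_rowLen]
    omega
  have h2 : ¬ c + 1 < ν.colLen b := by
    rw [← mem_iff_lt_colLen, mem_iff_lt_rowLen]
    omega
  refine h a b (mem_iff_lt_rowLen.mpr (by omega)) ?_
  rw [show hookLen ν a b = ℓ by unfold hookLen; omega]

theorem IsCore.rowLen_lt {ℓ : ℕ} (hℓ : 1 ≤ ℓ) {ν : YoungDiagram} (h : IsCore ℓ ν) (a : ℕ) :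
    ν.rowLen a < ν.rowLen (a + 1) + ℓ := by
  obtain ⟨c, hc⟩ := h.exists_row a
  rcases le_or_gt c a with hca | hca
  · have := ν.rowLen_anti _ _ hca
    omega
  · have := ν.rowLen_anti _ _ hca
    simp only [Nat.succ_eq_add_one] at this
    omega

theorem IsCore.regular {ℓ : ℕ} (hℓ : 1 ≤ ℓ) {ν : YoungDiagram} (h : IsCore ℓ ν) :
    Regular ℓ ν := by
  intro i hi
  have key : ∀ k, ν.rowLen (i + k) = ν.rowLen i ∧ ν.rowLen (i + k + ℓ - 1) = ν.rowLen i := by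
    intro k
    induction k with
    | zero => exact ⟨rfl, hi.symm⟩
    | succ k ih =>
      obtain ⟨c, hc⟩ := h.exists_row (i + k)
      have hle : i + k + ℓ ≤ c := by
        by_contra! hlt
        have h1 := ν.rowLen_anti c (i + k + ℓ - 1) (by omega)
        omega
      have h2 := ν.rowLen_anti (i + k) c (by omega)
      obtain rfl : c = i + k + ℓ := by omega
      have h3 := ν.rowLen_anti (i + (k + 1)) (i + k + ℓ) (by omega)
      have h4 := ν.rowLen_anti (i + k) (i + (k + 1)) (by omega)
      refine ⟨by omega, ?_⟩
      rw [show i + (k + 1) + ℓ - 1 = i + k + ℓ by omega]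
      omega
  rw [← (key (ν.colLen 0)).1, rowLen_eq_zero_iff]
  omega

/-- The rows of `lam` are those of `ν` lengthened by `ℓ` times those of `P`. -/
def IsDilation (ℓ : ℕ) (ν P lam : YoungDiagram) : Prop :=
  ∀ i, lam.rowLen i = ν.rowLen i + ℓ * P.rowLen i

theorem exists_isDilation (ℓ : ℕ) (ν P : YoungDiagram) : ∃ lam, IsDilation ℓ ν P lam := by
  refine exists_rowLen_eq (fun i => ν.rowLen i + ℓ * P.rowLen i)
    (fun i => add_le_add (ν.rowLen_succ_le i) (Nat.mul_le_mul_left ℓ (P.rowLen_succ_le i)))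
    (ν.colLen 0 + P.colLen 0) ?_
  simp [rowLen_eq_zero_iff.mpr]

theorem IsDilation.card {ℓ : ℕ} {ν P lam : YoungDiagram} (h : IsDilation ℓ ν P lam) :
    lam.cells.card = ν.cells.card + ℓ * P.cells.card := by
  have h1 : ν.rowLen (ν.colLen 0 + P.colLen 0) = 0 := rowLen_eq_zero_iff.mpr (by omega)
  have h2 : P.rowLen (ν.colLen 0 + P.colLen 0) = 0 := rowLen_eq_zero_iff.mpr (by omega)
  rw [card_cells_eq_sum ν _ h1, card_cells_eq_sum P _ h2,
    card_cells_eq_sum lam _ (by rw [h, h1, h2]; simp), Finset.mul_sum, ← Finset.sum_add_distrib]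
  exact Finset.sum_congr rfl fun i _ => h i

theorem exists_sub_row (lam : YoungDiagram) (a k : ℕ) (h : lam.rowLen (a + 1) + k ≤ lam.rowLen a) :
    ∃ μ : YoungDiagram, lam.rowLen a = μ.rowLen a + k ∧
      ∀ i, i ≠ a → lam.rowLen i = μ.rowLen i := by
  obtain ⟨μ, hμ⟩ := exists_rowLen_eq (fun i => if i = a then lam.rowLen a - k else lam.rowLen i)
    (fun i => by
      have := lam.rowLen_succ_le i
      split_ifs with h1 h2 h2
      · omega
      · subst h1; omega
      · subst h2; omega
      · omega)
    (lam.colLen 0 + a + 1) (by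
      rw [if_neg (by omega)]
      exact rowLen_eq_zero_iff.mpr (by omega))
  refine ⟨μ, ?_, fun i hi => ?_⟩
  · rw [hμ a, if_pos rfl]
    omega
  · rw [hμ i, if_neg hi]

theorem exists_add_row (lam : YoungDiagram) (a : ℕ)
    (h : ∀ b, a = b + 1 → lam.rowLen a < lam.rowLen b) :
    ∃ μ : YoungDiagram, μ.rowLen a = lam.rowLen a + 1 ∧
      ∀ i, i ≠ a → μ.rowLen i = lam.rowLen i := by
  obtain ⟨μ, hμ⟩ := exists_rowLen_eq (fun i => if i = a then lam.rowLen a + 1 else lam.rowLen i)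
    (fun i => by
      have := lam.rowLen_succ_le i
      split_ifs with h1 h2 h2
      · omega
      · have := h i h1.symm; omega
      · subst h2; omega
      · omega)
    (lam.colLen 0 + a + 1) (by
      rw [if_neg (by omega)]
      exact rowLen_eq_zero_iff.mpr (by omega))
  exact ⟨μ, by rw [hμ a, if_pos rfl], fun i hi => by rw [hμ i, if_neg hi]⟩

theorem IsDilation.reflTransGen {ℓ : ℕ} {ν P lam : YoungDiagram} (h : IsDilation ℓ ν P lam) :
    Relation.ReflTransGen (RemoveHorizHook ℓ) lam ν := by
  induction hn : P.cells.card generalizing P lam with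
  | zero =>
    have h0 : P.cells = ∅ := Finset.card_eq_zero.mp hn
    have : lam = ν := ext_rowLen fun i => by
      have : P.rowLen i = 0 := by
        by_contra hne
        have h1 : (i, 0) ∈ P.cells := mem_iff_lt_rowLen.mpr (Nat.pos_of_ne_zero hne)
        simp [h0] at h1
      rw [h, this]
      simp
    rw [this]
  | succ n ih =>
    have hcol : P.colLen 0 ≠ 0 := by
      intro h0
      have := card_cells_eq_sum P 0 (rowLen_eq_zero_iff.mpr h0.le)
      rw [Finset.sum_range_zero] at this
      omega
    obtain ⟨a, ha⟩ := Nat.exists_eq_succ_of_ne_zero hcol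
    have h1 : P.rowLen (a + 1) = 0 := rowLen_eq_zero_iff.mpr (by omega)
    have h2 : P.rowLen a ≠ 0 := fun h0 => by
      have := rowLen_eq_zero_iff.mp h0
      omega
    obtain ⟨Q, hQ, hQ'⟩ := exists_sub_row P a 1 (by omega)
    obtain ⟨μ, hμ⟩ := exists_isDilation ℓ ν Q
    have hcard : n = Q.cells.card := by
      obtain ⟨s, ⟨R, hR, hs, hs1, -⟩, -, hQs⟩ := removeHorizHook_of_rowLen a hQ hQ'
      have h3 : s ⊆ P.cells := hs ▸ Finset.sdiff_subset
      rw [hQs, Finset.card_sdiff_of_subset h3]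
      omega
    refine .head (removeHorizHook_of_rowLen a ?_ fun i hi => ?_) (ih hμ hcard.symm)
    · rw [h a, hμ a, hQ]
      ring
    · rw [h i, hμ i, hQ' i hi]

section Core

variable {ℓ r : ℕ} {ν : YoungDiagram}

theorem IsDilation.horizontal (hcore : IsCore ℓ ν)
    (h1 : ∀ i < r, ν.rowLen i = ν.rowLen (i + 1) + (ℓ - 1))
    {P lam : YoungDiagram} (hP : P.rowLen (r + 1) = 0) (h : IsDilation ℓ ν P lam)
    {s : Finset (ℕ × ℕ)} (hs : IsRemovableRimHook ℓ lam s) : HorizontalCells s := by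
  by_contra hhor
  obtain ⟨a, b, hab, hlt, hle⟩ := hs.exists_rows hhor
  have hP' : ∀ i, r < i → P.rowLen i = 0 := fun i hi => by
    have := P.rowLen_anti (r + 1) i hi
    omega
  have hνb := ν.rowLen_anti a b hab.le
  rcases lt_or_ge a r with har | har
  · have h2 := lam.rowLen_anti (a + 1) b hab
    have h3 := h a
    have h4 := h (a + 1)
    have h5 := Nat.mul_le_mul_left ℓ (P.rowLen_succ_le a)
    have h6 := h1 a har
    omega
  · have hb := h b
    rw [hP' b (by omega)] at hb
    have ha := h a
    rcases Nat.eq_zero_or_pos (P.rowLen a) with h0 | hpos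
    · rw [h0] at ha
      obtain ⟨c, hc⟩ := hcore.exists_row a
      have hac : a ≤ c := by
        by_contra! hlt'
        have := ν.rowLen_anti c a hlt'.le
        omega
      rcases le_or_gt c b with hcb | hcb
      · have := ν.rowLen_anti c b hcb
        omega
      · have h2 := ν.rowLen_anti (b + 1) c hcb
        have h3 := h (b + 1)
        omega
    · have := Nat.mul_le_mul_left ℓ hpos
      simp only [Nat.succ_eq_add_one, zero_add, mul_one] at this
      omega

theorem IsDilation.regular (hℓ : 2 ≤ ℓ) (hcore : IsCore ℓ ν)
    (h1 : ∀ i < r, ν.rowLen i = ν.rowLen (i + 1) + (ℓ - 1))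
    {P lam : YoungDiagram} (hP : P.rowLen (r + 1) = 0) (h : IsDilation ℓ ν P lam) :
    Regular ℓ lam := by
  intro i hi
  have h2 := lam.rowLen_anti (i + 1) (i + ℓ - 1) (by omega)
  have h3 := h i
  have h4 := h (i + 1)
  have h5 := Nat.mul_le_mul_left ℓ (P.rowLen_succ_le i)
  have h6 := ν.rowLen_succ_le i
  rcases lt_or_ge i r with hir | hir
  · have := h1 i hir
    omega
  · have h7 : P.rowLen (i + 1) = 0 := by
      have := P.rowLen_anti (r + 1) (i + 1) (by omega)
      omega
    have h8 : P.rowLen (i + ℓ - 1) = 0 := by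
      have := P.rowLen_anti (i + 1) (i + ℓ - 1) (by omega)
      omega
    have h9 := h (i + ℓ - 1)
    rw [h7] at h4
    rw [h8] at h9
    have h10 : ℓ * P.rowLen i = 0 := by omega
    have := hcore.regular (by omega) i (by omega)
    omega

theorem IsDilation.of_removeHorizHook (hℓ : 2 ≤ ℓ) (hcore : IsCore ℓ ν)
    {P lam μ : YoungDiagram} (hP : P.rowLen (r + 1) = 0) (h : IsDilation ℓ ν P lam)
    (hμ : RemoveHorizHook ℓ lam μ) :
    ∃ Q : YoungDiagram, Q.rowLen (r + 1) = 0 ∧ IsDilation ℓ ν Q μ := by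
  obtain ⟨a, ha, hne⟩ := hμ.exists_row (by omega)
  have hlt : P.rowLen (a + 1) < P.rowLen a := by
    by_contra! hle
    have h1 := Nat.mul_le_mul_left ℓ hle
    have h2 := μ.rowLen_succ_le a
    have h3 := hne (a + 1) (by omega)
    have h4 := h a
    have h5 := h (a + 1)
    have := hcore.rowLen_lt (by omega) a
    omega
  obtain ⟨Q, hQ, hQ'⟩ := exists_sub_row P a 1 hlt
  refine ⟨Q, ?_, fun i => ?_⟩
  · rcases eq_or_ne (r + 1) a with hr | hr
    · subst hr
      omega
    · rw [← hQ' _ hr, hP]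
  · rcases eq_or_ne i a with rfl | hi
    · have := h i
      rw [hQ, mul_add] at this
      omega
    · rw [← hne i hi, h i, hQ' i hi]

theorem IsDilation.isEllPartition (hℓ : 2 ≤ ℓ) (hcore : IsCore ℓ ν)
    (h1 : ∀ i < r, ν.rowLen i = ν.rowLen (i + 1) + (ℓ - 1))
    {P lam : YoungDiagram} (hP : P.rowLen (r + 1) = 0) (h : IsDilation ℓ ν P lam) :
    IsEllPartition ℓ lam := by
  refine ⟨h.regular hℓ hcore h1 hP, fun μ hμ s hs => ?_⟩
  obtain ⟨Q, hQ, hμQ⟩ : ∃ Q : YoungDiagram, Q.rowLen (r + 1) = 0 ∧ IsDilation ℓ ν Q μ := by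
    clear hs
    induction hμ with
    | refl => exact ⟨P, hP, h⟩
    | tail _ hstep ih =>
      obtain ⟨Q, hQ, hμQ⟩ := ih
      exact hμQ.of_removeHorizHook hℓ hcore hQ hstep
  exact hμQ.horizontal hcore h1 hQ hs

/-- Every removable `ℓ`-rim hook of `lam`, also after removing horizontal ones, is horizontal. -/
def HereditarilyHorizontal (ℓ : ℕ) (lam : YoungDiagram) : Prop :=
  ∀ μ : YoungDiagram, Relation.ReflTransGen (RemoveHorizHook ℓ) lam μ →
    ∀ s, IsRemovableRimHook ℓ μ s → HorizontalCells s

theorem HereditarilyHorizontal.of_removeHorizHook {lam μ : YoungDiagram}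
    (h : HereditarilyHorizontal ℓ lam) (hμ : RemoveHorizHook ℓ lam μ) :
    HereditarilyHorizontal ℓ μ :=
  fun κ hκ => h κ (.head hμ hκ)

theorem not_hereditarilyHorizontal (h2 : ν.rowLen r + 2 ≤ ν.rowLen (r + 1) + ℓ) (k : ℕ)
    {lam : YoungDiagram} (hr : lam.rowLen r = ν.rowLen r + ℓ * (k + 1))
    (hr1 : lam.rowLen (r + 1) = ν.rowLen (r + 1) + ℓ)
    (hr2 : lam.rowLen (r + 2) = ν.rowLen (r + 2)) : ¬ HereditarilyHorizontal ℓ lam := by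
  induction k generalizing lam with
  | zero =>
    intro h
    have h3 := ν.rowLen_anti r (r + 2) (by omega)
    rw [zero_add, mul_one] at hr
    obtain ⟨s, hs, hs'⟩ := exists_not_horizontal_rimHook (ℓ := ℓ) (lam := lam) (a := r)
      (by omega) (by omega)
    exact hs' (h lam .refl s hs)
  | succ k ih =>
    intro h
    have h3 := ν.rowLen_succ_le r
    have h4 : ℓ * (k + 1 + 1) = ℓ * k + ℓ + ℓ := by ring
    have h5 : ℓ * (k + 1) = ℓ * k + ℓ := by ring
    obtain ⟨μ, hμ, hμ'⟩ := exists_sub_row lam r ℓ (by omega)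
    refine ih (lam := μ) (by omega) ?_ ?_
      (h.of_removeHorizHook (removeHorizHook_of_rowLen r hμ hμ'))
    · rw [← hμ' _ (by omega), hr1]
    · rw [← hμ' _ (by omega), hr2]

theorem IsDilation.exists_of_add (hℓ : 2 ≤ ℓ) (hcore : IsCore ℓ ν)
    (h1 : ∀ i < r, ν.rowLen i = ν.rowLen (i + 1) + (ℓ - 1))
    (h2 : ν.rowLen r + 2 ≤ ν.rowLen (r + 1) + ℓ)
    {P lam μ : YoungDiagram} (hP : P.rowLen (r + 1) = 0) (h : IsDilation ℓ ν P μ)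
    (hμ : RemoveHorizHook ℓ lam μ) (hlam : HereditarilyHorizontal ℓ lam) :
    ∃ Q : YoungDiagram, Q.rowLen (r + 1) = 0 ∧ IsDilation ℓ ν Q lam := by
  obtain ⟨a, ha, hne⟩ := hμ.exists_row (by omega)
  have hP' : ∀ i, r < i → P.rowLen i = 0 := fun i hi => by
    have := P.rowLen_anti (r + 1) i hi
    omega
  have hprev : ∀ b, a = b + 1 → P.rowLen a < P.rowLen b := by
    rintro b rfl
    by_contra! hle
    have h3 := Nat.mul_le_mul_left ℓ hle
    have h4 := lam.rowLen_succ_le b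
    have h5 := hne b (by omega)
    have h6 := h b
    have h7 := h (b + 1)
    have := hcore.rowLen_lt (by omega) b
    omega
  have har : a ≤ r := by
    by_contra! hra
    obtain ⟨b, rfl⟩ : ∃ b, a = b + 1 := ⟨a - 1, by omega⟩
    have h3 := hprev b rfl
    obtain rfl : b = r := by
      by_contra hbr
      have := hP' b (by omega)
      omega
    refine not_hereditarilyHorizontal h2 (P.rowLen b - 1) ?_ ?_ ?_ hlam
    · rw [hne b (by omega), h b, show P.rowLen b - 1 + 1 = P.rowLen b by omega]
    · rw [ha, h, hP]
      simp
    · rw [hne _ (by omega), h, hP' _ (by omega)]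
      simp
  obtain ⟨Q, hQ, hQ'⟩ := exists_add_row P a hprev
  refine ⟨Q, ?_, fun i => ?_⟩
  · rw [hQ' _ (by omega), hP]
  · rcases eq_or_ne i a with rfl | hi
    · rw [ha, h i, hQ]
      ring
    · rw [hne i hi, h i, hQ' i hi]

theorem HereditarilyHorizontal.exists_isDilation (hℓ : 2 ≤ ℓ) (hcore : IsCore ℓ ν)
    (h1 : ∀ i < r, ν.rowLen i = ν.rowLen (i + 1) + (ℓ - 1))
    (h2 : ν.rowLen r + 2 ≤ ν.rowLen (r + 1) + ℓ) {lam : YoungDiagram}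
    (hlam : HereditarilyHorizontal ℓ lam) (hν : Relation.ReflTransGen (RemoveHook ℓ) lam ν) :
    ∃ P : YoungDiagram, P.rowLen (r + 1) = 0 ∧ IsDilation ℓ ν P lam := by
  induction hν using Relation.ReflTransGen.head_induction_on with
  | refl =>
    have h0 : ∀ i, (⊥ : YoungDiagram).rowLen i = 0 := fun i => by
      by_contra hne
      exact notMem_bot _ (mem_iff_lt_rowLen.mpr (Nat.pos_of_ne_zero hne))
    exact ⟨⊥, h0 _, fun i => by simp [h0]⟩
  | head hstep _ ih =>
    obtain ⟨s, hs, hcells⟩ := hstep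
    have hstep' := (⟨s, hs, hlam _ .refl s hs, hcells⟩ : RemoveHorizHook ℓ _ _)
    obtain ⟨P, hP, hdil⟩ := ih (hlam.of_removeHorizHook hstep')
    exact hdil.exists_of_add hℓ hcore h1 h2 hP hstep' hlam

end Core

/-- The partition of `μ.cells.card` formed by the row lengths of `μ`. -/
def YoungDiagram.toPartition (μ : YoungDiagram) (w : ℕ) (h : μ.cells.card = w) :
    Nat.Partition w where
  parts := μ.rowLens
  parts_pos hi := μ.pos_of_mem_rowLens _ (by simpa using hi)
  parts_sum := by
    rw [← h, card_cells_eq_sum μ (μ.colLen 0) (rowLen_eq_zero_iff.mpr le_rfl), Multiset.sum_coe,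
      rowLens]
    rfl

theorem card_youngDiagram_eq_card_partition (k w : ℕ) :
    Nat.card {P : YoungDiagram // P.cells.card = w ∧ P.rowLen k = 0} =
      Nat.card {p : Nat.Partition w // Multiset.card p.parts ≤ k} := by
  refine Nat.card_eq_of_bijective
    (fun P => ⟨P.1.toPartition w P.2.1, by
      simpa [toPartition, length_rowLens] using rowLen_eq_zero_iff.mp P.2.2⟩) ⟨?_, ?_⟩
  · rintro ⟨P, hP⟩ ⟨Q, hQ⟩ hPQ
    have h1 : (P.rowLens : Multiset ℕ) = Q.rowLens :=
      congrArg (fun p => p.1.parts) hPQ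
    have h2 : P.rowLens = Q.rowLens :=
      (Multiset.coe_eq_coe.mp h1).eq_of_sortedGE P.rowLens_sorted Q.rowLens_sorted
    exact Subtype.ext (equivListRowLens.injective (Subtype.ext h2))
  · rintro ⟨p, hp⟩
    have hsort : (p.parts.sort (· ≥ ·)).SortedGE :=
      (Multiset.pairwise_sort p.parts (· ≥ ·)).sortedGE
    have hlens := rowLens_ofRowLens_eq_self (hw := hsort)
      fun x hx => p.parts_pos ((Multiset.mem_sort _).mp hx)
    have hparts : ((ofRowLens _ hsort).rowLens : Multiset ℕ) = p.parts := by
      rw [hlens, Multiset.sort_eq]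
    refine ⟨⟨ofRowLens _ hsort, ?_, ?_⟩, ?_⟩
    · rw [← ((ofRowLens _ hsort).toPartition _ rfl).parts_sum]
      exact (congrArg Multiset.sum hparts).trans p.parts_sum
    · rw [rowLen_eq_zero_iff, ← length_rowLens, ← Multiset.coe_card, hparts]
      exact hp
    · exact Subtype.ext (Nat.Partition.ext hparts)

/-- Let `ν` be an `ℓ`-core whose first `r` successive row differences equal `ℓ - 1`
and whose `(r+1)`-st difference does not.  Then the number of `ℓ`-partitions of
weight `w` whose `ℓ`-core is `ν` equals the number of partitions of `w` into at
most `r + 1` parts. -/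
theorem stmt_11 (ℓ r w : ℕ) (hℓ : 2 ≤ ℓ) (ν : YoungDiagram)
    (hcore : IsCore ℓ ν)
    (h1 : ∀ i < r, ν.rowLen i - ν.rowLen (i + 1) = ℓ - 1)
    (h2 : ν.rowLen r - ν.rowLen (r + 1) ≠ ℓ - 1) :
    Nat.card {lam : YoungDiagram // IsEllPartition ℓ lam ∧
        Relation.ReflTransGen (RemoveHook ℓ) lam ν ∧
        lam.cells.card = ν.cells.card + ℓ * w} =
      Nat.card {p : Nat.Partition w // Multiset.card p.parts ≤ r + 1} := by
  rw [← card_youngDiagram_eq_card_partition]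
  have h1' : ∀ i < r, ν.rowLen i = ν.rowLen (i + 1) + (ℓ - 1) := fun i hi => by
    have := h1 i hi
    omega
  have h2' : ν.rowLen r + 2 ≤ ν.rowLen (r + 1) + ℓ := by
    have := hcore.rowLen_lt (by omega) r
    omega
  choose D hD using exists_isDilation ℓ ν
  symm
  refine Nat.card_eq_of_bijective
    (fun P => ⟨D P.1, (hD P.1).isEllPartition hℓ hcore h1' P.2.2,
      Relation.ReflTransGen.mono (fun _ _ => RemoveHorizHook.removeHook) _ _ (hD P.1).reflTransGen,
      by rw [(hD P.1).card, P.2.1]⟩) ⟨?_, ?_⟩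
  · rintro ⟨P, hP⟩ ⟨Q, hQ⟩ hPQ
    have hPQ' : D P = D Q := congrArg Subtype.val hPQ
    refine Subtype.ext (ext_rowLen fun i => ?_)
    have h3 := hD P i
    rw [hPQ', hD Q i] at h3
    exact (Nat.eq_of_mul_eq_mul_left (by omega) (Nat.add_left_cancel h3)).symm
  · rintro ⟨lam, hlam, hred, hcard⟩
    obtain ⟨P, hP, hdil⟩ :=
      HereditarilyHorizontal.exists_isDilation hℓ hcore h1' h2' hlam.2 hred
    refine ⟨⟨P, ?_, hP⟩, Subtype.ext (ext_rowLen fun i => ?_)⟩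
    · have h3 := hdil.card
      rw [hcard] at h3
      exact (Nat.eq_of_mul_eq_mul_left (by omega) (Nat.add_left_cancel h3)).symm
    · rw [hD P i, hdil i]
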